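/- Let p be a prime and let n ≥ 2 and l ≥ 1 be integers. Let y ∈ GL_n(ℚ_p) and let u ∈ ℚ_p^n be a column vector; assume min_{i,j} v_p(y_{ij}) ≤ 0 and min_i v_p(u_i) ≤ 0, and set e := −min_{i,j} v_p(y_{ij}), e′ := −min_i v_p(u_i). Assume e ≥ e′, and suppose there exists λ ∈ ℚ_p^× such that λ·[[y,u],[0,1]] ∈ GL_{n+1}(ℤ_p)·diag(1,…,1,p^{−l})·GL_{n+1}(ℤ_p). Then e = l, and there exist a permutation matrix w, a column vector u″ ∈ ℚ_p^{n−1} with every entry in p^{−l}ℤ_p, and k ∈ GL_n(ℤ_p), such that w·y = diag(1,…,1,p^{−l})·U(u″)·k; moreover, writing w·u = (u′; α) with u′ ∈ ℚ_p^{n−1} and last coordinate α ∈ ℚ_p, one has α ∈ p^{−l}ℤ_p and u′ − α·p^l·u″ ∈ ℤ_p^{n−1}. -/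

import Mathlib

open Matrix

/-- Membership in `GL(ℤ_p)`: all entries are `p`-adic integers and the determinant is a
`p`-adic unit. -/
def IsGLZ (p : ℕ) [Fact p.Prime] {ι : Type*} [Fintype ι] [DecidableEq ι]
    (g : Matrix ι ι ℚ_[p]) : Prop :=
  (∀ i j, ‖g i j‖ ≤ 1) ∧ ‖g.det‖ = 1

/-- The permutation matrix attached to a permutation `σ`. -/
noncomputable def permMat (p : ℕ) [Fact p.Prime] {ι : Type*} [DecidableEq ι] (σ : Equiv.Perm ι) :
    Matrix ι ι ℚ_[p] :=
  Matrix.of (fun i j => if i = σ j then 1 else 0)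

/-- The block matrix `[[y, u], [0, 1]]`. -/
noncomputable def blockExt (p : ℕ) [Fact p.Prime] {ι : Type*} (y : Matrix ι ι ℚ_[p]) (u : ι → ℚ_[p]) :
    Matrix (ι ⊕ Unit) (ι ⊕ Unit) ℚ_[p] :=
  Matrix.fromBlocks y (Matrix.of (fun i _ => u i)) 0 1

/-- The unipotent matrix `U(u″)` with upper-left block `I`, last column `(u″;1)` and last
row `(0,…,0,1)`. -/
noncomputable def Umat (p : ℕ) [Fact p.Prime] {m : ℕ} (u'' : Fin m → ℚ_[p]) :
    Matrix (Fin m ⊕ Unit) (Fin m ⊕ Unit) ℚ_[p] :=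
  Matrix.of (fun i j =>
    match i, j with
    | Sum.inl a, Sum.inl b => if a = b then 1 else 0
    | Sum.inl a, Sum.inr _ => u'' a
    | Sum.inr _, Sum.inl _ => 0
    | Sum.inr _, Sum.inr _ => 1)

/-- `w·u`, the image of the vector `u` under the permutation matrix of `σ`. -/
noncomputable def wvec (p : ℕ) [Fact p.Prime] {ι : Type*} [Fintype ι] [DecidableEq ι]
    (σ : Equiv.Perm ι) (u : ι → ℚ_[p]) : ι → ℚ_[p] :=
  (permMat p σ).mulVec u

section Ultrametric

theorem norm_mul_apply_le {p : ℕ} [Fact p.Prime] {ι : Type*} [Fintype ι]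
    {A B : Matrix ι ι ℚ_[p]} {r s : ℝ} (hr : 0 ≤ r) (hs : 0 ≤ s)
    (hA : ∀ i j, ‖A i j‖ ≤ r) (hB : ∀ i j, ‖B i j‖ ≤ s) (i j : ι) :
    ‖(A * B) i j‖ ≤ r * s := by
  rw [Matrix.mul_apply]
  refine IsUltrametricDist.norm_sum_le_of_forall_le_of_nonneg (by positivity) fun k _ => ?_
  rw [norm_mul]
  exact mul_le_mul (hA i k) (hB k j) (norm_nonneg _) hr

variable {p : ℕ} [Fact p.Prime] {ι : Type*} [Fintype ι] [DecidableEq ι]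

theorem norm_det_le_one {A : Matrix ι ι ℚ_[p]} (hA : ∀ i j, ‖A i j‖ ≤ 1) : ‖A.det‖ ≤ 1 := by
  rw [Matrix.det_apply']
  refine IsUltrametricDist.norm_sum_le_of_forall_le_of_nonneg zero_le_one fun σ _ => ?_
  rw [norm_mul, norm_prod]
  refine mul_le_one₀ (Padic.norm_int_le_one _)
    (Finset.prod_nonneg fun _ _ => norm_nonneg _) ?_
  exact Finset.prod_le_one (fun _ _ => norm_nonneg _) fun _ _ => hA _ _

namespace IsGLZ

theorem isUnit_det {g : Matrix ι ι ℚ_[p]} (hg : IsGLZ p g) : IsUnit g.det := by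
  rw [isUnit_iff_ne_zero, ← norm_ne_zero_iff, hg.2]
  exact one_ne_zero

theorem norm_inv_apply_le {g : Matrix ι ι ℚ_[p]} (hg : IsGLZ p g) (i j : ι) :
    ‖g⁻¹ i j‖ ≤ 1 := by
  rw [Matrix.inv_def, Matrix.smul_apply, smul_eq_mul, norm_mul, Ring.inverse_eq_inv', norm_inv,
    hg.2, inv_one, one_mul, Matrix.adjugate_apply]
  refine norm_det_le_one fun a b => ?_
  rw [Matrix.updateRow_apply]
  split_ifs
  · rw [Pi.single_apply]
    split_ifs <;> simp
  · exact hg.1 a b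

end IsGLZ

theorem norm_natCast_zpow_neg (l : ℕ) : ‖(p : ℚ_[p]) ^ (-(l : ℤ))‖ = (p : ℝ) ^ l := by
  simp

end Ultrametric

section DoubleCoset

variable {p : ℕ} [Fact p.Prime] {ι : Type*} [Fintype ι] [DecidableEq ι]

/-- The matrix `diag(1,…,1,p^{-l})`. -/
noncomputable abbrev heckeDiag (p : ℕ) [Fact p.Prime] (ι : Type*) [DecidableEq ι] (l : ℕ) :
    Matrix (ι ⊕ Unit) (ι ⊕ Unit) ℚ_[p] :=
  Matrix.diagonal (Sum.elim (fun _ : ι => (1 : ℚ_[p])) (fun _ : Unit => (p : ℚ_[p]) ^ (-(l : ℤ))))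

theorem det_heckeDiag (l : ℕ) : (heckeDiag p ι l).det = (p : ℚ_[p]) ^ (-(l : ℤ)) := by
  simp [Matrix.det_diagonal]

/-- A matrix in the double coset of `diag(1,…,1,p^{-l})` is, up to an integral matrix, `p^{-l}`
times an integral matrix of rank one. -/
theorem exists_rank_one_approx {l : ℕ} {A k₁ k₂ : Matrix (ι ⊕ Unit) (ι ⊕ Unit) ℚ_[p]}
    (h₁ : IsGLZ p k₁) (h₂ : IsGLZ p k₂) (hA : A = k₁ * heckeDiag p ι l * k₂) :
    ∃ (M : Matrix (ι ⊕ Unit) (ι ⊕ Unit) ℚ_[p]) (a b : ι ⊕ Unit → ℚ_[p]),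
      (∀ i j, ‖M i j‖ ≤ 1) ∧ (∀ i, ‖a i‖ ≤ 1) ∧ (∀ j, ‖b j‖ ≤ 1) ∧
      ∀ i j, A i j = M i j + (p : ℚ_[p]) ^ (-(l : ℤ)) * (a i * b j) := by
  refine ⟨Matrix.of fun i j => ∑ x : ι, k₁ i (Sum.inl x) * k₂ (Sum.inl x) j,
    fun i => k₁ i (Sum.inr ()), fun j => k₂ (Sum.inr ()) j, fun i j => ?_, fun i => h₁.1 _ _,
    fun j => h₂.1 _ _, fun i j => ?_⟩
  · refine IsUltrametricDist.norm_sum_le_of_forall_le_of_nonneg zero_le_one fun x _ => ?_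
    rw [norm_mul]
    exact mul_le_one₀ (h₁.1 _ _) (norm_nonneg _) (h₂.1 _ _)
  · rw [hA, Matrix.mul_apply]
    simp only [Matrix.mul_diagonal, Fintype.sum_sum_type, Sum.elim_inl, Sum.elim_inr, mul_one,
      Matrix.of_apply, Finset.univ_unique, Finset.sum_singleton]
    change _ + k₁ i (Sum.inr ()) * _ * k₂ (Sum.inr ()) j = _
    ring

/-- The `2 × 2` minors of a matrix in the double coset of `diag(1,…,1,p^{-l})` lie in
`p^{-l}ℤ_p`. -/
theorem norm_minor_le {l : ℕ} {A k₁ k₂ : Matrix (ι ⊕ Unit) (ι ⊕ Unit) ℚ_[p]}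
    (h₁ : IsGLZ p k₁) (h₂ : IsGLZ p k₂) (hA : A = k₁ * heckeDiag p ι l * k₂)
    (i i' j j' : ι ⊕ Unit) : ‖A i j * A i' j' - A i j' * A i' j‖ ≤ (p : ℝ) ^ l := by
  obtain ⟨M, a, b, hM, ha, hb, h⟩ := exists_rank_one_approx h₁ h₂ hA
  have hp : (1 : ℝ) ≤ (p : ℝ) ^ l :=
    one_le_pow₀ (by exact_mod_cast (Fact.out : p.Prime).one_le)
  have mem : ∀ {x : ℚ_[p]}, ‖x‖ ≤ 1 → x ∈ PadicInt.subring p := fun hx => hx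
  have key : A i j * A i' j' - A i j' * A i' j =
      (M i j * M i' j' - M i j' * M i' j) + (p : ℚ_[p]) ^ (-(l : ℤ)) *
        (M i j * (a i' * b j') + a i * b j * M i' j'
          - M i j' * (a i' * b j) - a i * b j' * M i' j) := by
    simp only [h]; ring
  have hM' := fun i j => mem (hM i j)
  have ha' := fun i => mem (ha i)
  have hb' := fun i => mem (hb i)
  have hx : M i j * M i' j' - M i j' * M i' j ∈ PadicInt.subring p :=
    sub_mem (mul_mem (hM' _ _) (hM' _ _)) (mul_mem (hM' _ _) (hM' _ _))
  have hz : M i j * (a i' * b j') + a i * b j * M i' j' - M i j' * (a i' * b j)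
      - a i * b j' * M i' j ∈ PadicInt.subring p :=
    sub_mem (sub_mem (add_mem (mul_mem (hM' _ _) (mul_mem (ha' _) (hb' _)))
      (mul_mem (mul_mem (ha' _) (hb' _)) (hM' _ _)))
      (mul_mem (hM' _ _) (mul_mem (ha' _) (hb' _))))
      (mul_mem (mul_mem (ha' _) (hb' _)) (hM' _ _))
  rw [key]
  refine (Padic.nonarchimedean _ _).trans (max_le (le_trans hx hp) ?_)
  rw [norm_mul, norm_natCast_zpow_neg]
  exact mul_le_of_le_one_right (by positivity) hz

theorem norm_apply_le {l : ℕ} {A k₁ k₂ : Matrix (ι ⊕ Unit) (ι ⊕ Unit) ℚ_[p]}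
    (h₁ : IsGLZ p k₁) (h₂ : IsGLZ p k₂) (hA : A = k₁ * heckeDiag p ι l * k₂)
    (i j : ι ⊕ Unit) : ‖A i j‖ ≤ (p : ℝ) ^ l := by
  obtain ⟨M, a, b, hM, ha, hb, h⟩ := exists_rank_one_approx h₁ h₂ hA
  have hp : (1 : ℝ) ≤ (p : ℝ) ^ l :=
    one_le_pow₀ (by exact_mod_cast (Fact.out : p.Prime).one_le)
  rw [h]
  refine (Padic.nonarchimedean _ _).trans (max_le ((hM _ _).trans hp) ?_)
  rw [norm_mul, norm_natCast_zpow_neg, norm_mul]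
  exact mul_le_of_le_one_right (by positivity) (mul_le_one₀ (ha _) (norm_nonneg _) (hb _))

/-- Some entry of a matrix in the double coset of `diag(1,…,1,p^{-l})` has norm at least `p^l`. -/
theorem le_of_forall_norm_apply_le {l : ℕ} {A k₁ k₂ : Matrix (ι ⊕ Unit) (ι ⊕ Unit) ℚ_[p]}
    (h₁ : IsGLZ p k₁) (h₂ : IsGLZ p k₂) (hA : A = k₁ * heckeDiag p ι l * k₂)
    {r : ℝ} (hr : ∀ i j, ‖A i j‖ ≤ r) : (p : ℝ) ^ l ≤ r := by
  have hr0 : 0 ≤ r := (norm_nonneg _).trans (hr (Sum.inr ()) (Sum.inr ()))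
  have hD : heckeDiag p ι l = k₁⁻¹ * A * k₂⁻¹ := by
    rw [hA, Matrix.mul_assoc k₁, Matrix.nonsing_inv_mul_cancel_left _ _ h₁.isUnit_det,
      Matrix.mul_nonsing_inv_cancel_right _ _ h₂.isUnit_det]
  have h := norm_mul_apply_le (A := k₁⁻¹ * A) (B := k₂⁻¹) (by positivity) zero_le_one
    (norm_mul_apply_le zero_le_one hr0 h₁.norm_inv_apply_le hr) h₂.norm_inv_apply_le
    (Sum.inr ()) (Sum.inr ())
  rw [← hD, one_mul, mul_one] at h
  rwa [show heckeDiag p ι l (Sum.inr ()) (Sum.inr ()) = (p : ℚ_[p]) ^ (-(l : ℤ)) from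
    Matrix.diagonal_apply_eq _ _, norm_natCast_zpow_neg] at h

theorem exists_integral_right_inverse {l : ℕ} {A k₁ k₂ : Matrix (ι ⊕ Unit) (ι ⊕ Unit) ℚ_[p]}
    (h₁ : IsGLZ p k₁) (h₂ : IsGLZ p k₂) (hA : A = k₁ * heckeDiag p ι l * k₂) :
    ∃ N : Matrix (ι ⊕ Unit) (ι ⊕ Unit) ℚ_[p], (∀ i j, ‖N i j‖ ≤ 1) ∧ A * N = 1 := by
  have hp0 : (p : ℚ_[p]) ≠ 0 := by exact_mod_cast (Fact.out : p.Prime).ne_zero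
  set E : Matrix (ι ⊕ Unit) (ι ⊕ Unit) ℚ_[p] :=
    Matrix.diagonal (Sum.elim (fun _ : ι => 1) (fun _ : Unit => (p : ℚ_[p]) ^ l)) with hE
  have hE1 : ∀ i j, ‖E i j‖ ≤ 1 := fun i j => by
    rw [hE, Matrix.diagonal_apply]
    split_ifs
    · rcases i with i | i
      · simp
      · rw [Sum.elim_inr, norm_pow]
        exact pow_le_one₀ (norm_nonneg _) Padic.norm_p_lt_one.le
    · simp
  have hDE : heckeDiag p ι l * E = 1 := by
    rw [hE, Matrix.diagonal_mul_diagonal, ← Matrix.diagonal_one]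
    congr 1
    ext (i | i)
    · simp
    · simp [hp0]
  refine ⟨k₂⁻¹ * E * k₁⁻¹, fun i j => ?_, ?_⟩
  · simpa using norm_mul_apply_le (by positivity) zero_le_one
      (norm_mul_apply_le zero_le_one zero_le_one h₂.norm_inv_apply_le hE1)
      h₁.norm_inv_apply_le i j
  · rw [hA, Matrix.mul_assoc k₂⁻¹, Matrix.mul_assoc (k₁ * heckeDiag p ι l),
      Matrix.mul_nonsing_inv_cancel_left _ _ h₂.isUnit_det, Matrix.mul_assoc k₁,
      ← Matrix.mul_assoc _ E, hDE, Matrix.one_mul, Matrix.mul_nonsing_inv _ h₁.isUnit_det]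

/-- If a multiple of `[[y, u], [0, 1]]` by `lam` lies in the double coset of `diag(1,…,1,p^{-l})`
and an entry of `y` has the largest norm, then `lam` is a unit. -/
theorem norm_eq_one_of_smul_blockExt {l : ℕ} {y : Matrix ι ι ℚ_[p]} {u : ι → ℚ_[p]}
    {k₁ k₂ : Matrix (ι ⊕ Unit) (ι ⊕ Unit) ℚ_[p]} (hl : 1 ≤ l)
    (h₁ : IsGLZ p k₁) (h₂ : IsGLZ p k₂) {lam : ℚ_[p]}
    (hA : lam • blockExt p y u = k₁ * heckeDiag p ι l * k₂) {i₀ j₀ : ι}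
    (hij : ‖lam * y i₀ j₀‖ = (p : ℝ) ^ l) : ‖lam‖ = 1 := by
  refine le_antisymm ?_ ?_
  · obtain ⟨M, a, b, hM, ha, hb, h⟩ := exists_rank_one_approx h₁ h₂ hA
    have hp : (1 : ℝ) < (p : ℝ) ^ l :=
      one_lt_pow₀ (by exact_mod_cast (Fact.out : p.Prime).one_lt) (by omega)
    have h₀ := h (Sum.inl i₀) (Sum.inl j₀)
    have h₃ := h (Sum.inr ()) (Sum.inl j₀)
    have h₄ := h (Sum.inr ()) (Sum.inr ())
    simp only [blockExt, Matrix.smul_apply, Matrix.fromBlocks_apply₁₁, Matrix.fromBlocks_apply₂₁,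
      Matrix.fromBlocks_apply₂₂, smul_eq_mul, Matrix.zero_apply, mul_zero,
      Matrix.one_apply_eq, mul_one] at h₀ h₃ h₄
    have hb₀ : ‖b (Sum.inl j₀)‖ = 1 := by
      refine le_antisymm (hb _) (le_of_not_gt fun hlt => ?_)
      have : ‖lam * y i₀ j₀‖ < (p : ℝ) ^ l := by
        rw [h₀]
        refine (Padic.nonarchimedean _ _).trans_lt
          (max_lt ((hM _ _).trans_lt hp) ?_)
        rw [norm_mul, norm_natCast_zpow_neg, norm_mul]
        exact mul_lt_of_lt_one_right (by positivity)
          (mul_lt_one_of_nonneg_of_lt_one_right (ha _) (norm_nonneg _) hlt)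
      exact this.ne hij
    have ha₀ : ‖(p : ℚ_[p]) ^ (-(l : ℤ)) * a (Sum.inr ())‖ ≤ 1 := by
      have : ‖(p : ℚ_[p]) ^ (-(l : ℤ)) * (a (Sum.inr ()) * b (Sum.inl j₀))‖ ≤ 1 := by
        rw [← neg_eq_of_add_eq_zero_right h₃.symm, norm_neg]
        exact hM _ _
      rwa [← mul_assoc, norm_mul, hb₀, mul_one] at this
    rw [h₄]
    refine (Padic.nonarchimedean _ _).trans (max_le (hM _ _) ?_)
    rw [← mul_assoc, norm_mul]
    exact mul_le_one₀ ha₀ (norm_nonneg _) (hb _)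
  · obtain ⟨N, hN, hAN⟩ := exists_integral_right_inverse h₁ h₂ hA
    have h := congrFun (congrFun hAN (Sum.inr ())) (Sum.inr ())
    rw [Matrix.mul_apply, Matrix.one_apply_eq] at h
    simp only [blockExt, Matrix.smul_apply, Fintype.sum_sum_type, Matrix.fromBlocks_apply₂₁,
      Matrix.fromBlocks_apply₂₂, smul_eq_mul, Matrix.zero_apply, mul_zero, zero_mul,
      Finset.sum_const_zero, zero_add, Finset.univ_unique, Finset.sum_singleton,
      PUnit.default_eq_unit, Matrix.one_apply_eq, mul_one] at h
    have h' := congrArg norm h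
    rw [norm_mul, norm_one] at h'
    rw [← h']
    exact mul_le_of_le_one_right (norm_nonneg _) (hN _ _)

theorem det_blockExt (y : Matrix ι ι ℚ_[p]) (u : ι → ℚ_[p]) : (blockExt p y u).det = y.det := by
  simp [blockExt]

end DoubleCoset

section Permutation

variable {p : ℕ} [Fact p.Prime] {ι : Type*} [Fintype ι] [DecidableEq ι]

theorem wvec_apply (σ : Equiv.Perm ι) (u : ι → ℚ_[p]) (i : ι) : wvec p σ u i = u (σ.symm i) := by
  simp [wvec, permMat, Matrix.mulVec, dotProduct, ← Equiv.symm_apply_eq]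

theorem permMat_mul (σ : Equiv.Perm ι) (y : Matrix ι ι ℚ_[p]) :
    permMat p σ * y = y.submatrix σ.symm id := by
  ext i j
  simp [permMat, Matrix.mul_apply, ← Equiv.symm_apply_eq]

theorem norm_det_permMat_mul (σ : Equiv.Perm ι) (y : Matrix ι ι ℚ_[p]) :
    ‖(permMat p σ * y).det‖ = ‖y.det‖ := by
  rw [permMat_mul, Matrix.det_permute, norm_mul]
  rcases Int.units_eq_one_or (Equiv.Perm.sign σ.symm) with h | h <;> simp [h]

end Permutation

section Iwasawa

variable {p : ℕ} [Fact p.Prime] {m : ℕ}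

theorem det_Umat (v : Fin m → ℚ_[p]) : (Umat p v).det = 1 := by
  have : Umat p v = Matrix.fromBlocks 1 (Matrix.of fun i _ => v i) 0 1 := by
    ext (i | i) (j | j) <;> simp [Umat, Matrix.one_apply]
  simp [this]

/-- Row reduction against the last row, whose entry in column `j₀` has the largest norm `p^l`:
the quotient by `diag(1,…,1,p^{-l}) · U(v)` is integral as soon as the relevant minors are
bounded by `p^l`. -/
theorem exists_isGLZ_eq_heckeDiag_mul_Umat_mul {l : ℕ}
    {z : Matrix (Fin m ⊕ Unit) (Fin m ⊕ Unit) ℚ_[p]} {v : Fin m → ℚ_[p]}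
    (hdet : ‖z.det‖ = (p : ℝ) ^ l) (hlast : ∀ j, ‖z (Sum.inr ()) j‖ ≤ (p : ℝ) ^ l)
    (hred : ∀ i j, ‖z (Sum.inl i) j - z (Sum.inr ()) j * (p : ℚ_[p]) ^ l * v i‖ ≤ 1) :
    ∃ k, IsGLZ p k ∧ z = heckeDiag p (Fin m) l * Umat p v * k := by
  have hp0 : (p : ℚ_[p]) ≠ 0 := by exact_mod_cast (Fact.out : p.Prime).ne_zero
  have hpl : 0 < (p : ℝ) ^ l := pow_pos (by exact_mod_cast (Fact.out : p.Prime).pos) l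
  set k : Matrix (Fin m ⊕ Unit) (Fin m ⊕ Unit) ℚ_[p] := Matrix.of fun i j =>
    Sum.elim (fun i => z (Sum.inl i) j - z (Sum.inr ()) j * (p : ℚ_[p]) ^ l * v i)
      (fun _ => (p : ℚ_[p]) ^ l * z (Sum.inr ()) j) i with hk
  have hz : z = heckeDiag p (Fin m) l * Umat p v * k := by
    ext i j
    rw [Matrix.mul_assoc, Matrix.diagonal_mul, Matrix.mul_apply]
    rcases i with i | ⟨⟩
    · simp [Umat, hk]
      ring
    · simp [Umat, hk, hp0]
  refine ⟨k, ⟨?_, ?_⟩, hz⟩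
  · rintro (i | i) j
    · exact hred i j
    · change ‖(p : ℚ_[p]) ^ l * z (Sum.inr ()) j‖ ≤ 1
      rw [norm_mul, norm_pow, Padic.norm_p, inv_pow, inv_mul_le_one₀ hpl]
      exact hlast j
  · have h := congrArg norm (congrArg Matrix.det hz)
    rw [Matrix.det_mul, Matrix.det_mul, det_heckeDiag, det_Umat, mul_one, norm_mul,
      norm_natCast_zpow_neg, hdet] at h
    exact (mul_eq_left₀ hpl.ne').1 h.symm

end Iwasawa

/-- case (A) of Lemma 6.1: support of the off-diagonal amplification
Hecke operator.  Here `n = m + 2` and the index set of size `n` is `Fin (m+1) ⊕ Unit`,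
the `Unit` being the last coordinate; `e = -min v_p(y_{ij})` and `e' = -min v_p(u_i)` are
encoded via attained sup-norm bounds. -/
theorem stmt1 (p : ℕ) [Fact p.Prime] (m : ℕ) (l : ℕ) (hl : 1 ≤ l)
    (y : Matrix (Fin (m+1) ⊕ Unit) (Fin (m+1) ⊕ Unit) ℚ_[p]) (hy : IsUnit y.det)
    (u : (Fin (m+1) ⊕ Unit) → ℚ_[p]) (e e' : ℕ)
    (hey : ∀ i j, ‖y i j‖ ≤ (p : ℝ) ^ e) (hey' : ∃ i j, ‖y i j‖ = (p : ℝ) ^ e)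
    (heu : ∀ i, ‖u i‖ ≤ (p : ℝ) ^ e') (heu' : ∃ i, ‖u i‖ = (p : ℝ) ^ e')
    (hee : e' ≤ e)
    (hcoset : ∃ lam : ℚ_[p], lam ≠ 0 ∧ ∃ k₁ k₂, IsGLZ p k₁ ∧ IsGLZ p k₂ ∧
      lam • blockExt p y u =
        k₁ * Matrix.diagonal (Sum.elim (fun _ : Fin (m+1) ⊕ Unit => (1 : ℚ_[p]))
          (fun _ : Unit => (p : ℚ_[p]) ^ (-(l : ℤ)))) * k₂) :
    e = l ∧
    ∃ (σ : Equiv.Perm (Fin (m+1) ⊕ Unit)) (u'' : Fin (m+1) → ℚ_[p])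
      (k : Matrix (Fin (m+1) ⊕ Unit) (Fin (m+1) ⊕ Unit) ℚ_[p]),
      (∀ i, ‖u'' i‖ ≤ (p : ℝ) ^ l) ∧
      IsGLZ p k ∧
      permMat p σ * y =
        Matrix.diagonal (Sum.elim (fun _ : Fin (m+1) => (1 : ℚ_[p]))
          (fun _ : Unit => (p : ℚ_[p]) ^ (-(l : ℤ)))) * Umat p u'' * k ∧
      ‖wvec p σ u (Sum.inr ())‖ ≤ (p : ℝ) ^ l ∧
      ∀ i : Fin (m+1),
        ‖wvec p σ u (Sum.inl i) - wvec p σ u (Sum.inr ()) * (p : ℚ_[p]) ^ l * u'' i‖ ≤ 1 := by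
  obtain ⟨lam, -, k₁, k₂, h₁, h₂, hA⟩ := hcoset
  obtain ⟨i₀, j₀, hij⟩ := hey'
  have hp1 : (1 : ℝ) < p := by exact_mod_cast (Fact.out : p.Prime).one_lt
  have hpl : 0 < (p : ℝ) ^ l := by positivity
  have hbound : ∀ i j, ‖(lam • blockExt p y u) i j‖ ≤ ‖lam‖ * (p : ℝ) ^ e := by
    intro i j
    rw [Matrix.smul_apply, smul_eq_mul, norm_mul]
    refine mul_le_mul_of_nonneg_left ?_ (norm_nonneg _)
    rcases i with i | i <;> rcases j with j | j
    · exact hey i j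
    · exact (heu i).trans (pow_le_pow_right₀ hp1.le hee)
    · simp [blockExt]
    · simpa [blockExt] using one_le_pow₀ hp1.le
  have hlam_mul : ‖lam * y i₀ j₀‖ = (p : ℝ) ^ l := by
    refine le_antisymm (norm_apply_le h₁ h₂ hA (Sum.inl i₀) (Sum.inl j₀)) ?_
    rw [norm_mul, hij]
    exact le_of_forall_norm_apply_le h₁ h₂ hA hbound
  have hlam : ‖lam‖ = 1 := norm_eq_one_of_smul_blockExt hl h₁ h₂ hA hlam_mul
  have hel : e = l := by
    rw [norm_mul, hlam, one_mul, hij] at hlam_mul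
    exact pow_right_injective₀ (by positivity) hp1.ne' hlam_mul
  subst hel
  have hdet : ‖y.det‖ = (p : ℝ) ^ e := by
    have h := congrArg norm (congrArg Matrix.det hA)
    rwa [Matrix.det_smul, det_blockExt, Matrix.det_mul, Matrix.det_mul, det_heckeDiag, norm_mul,
      norm_mul, norm_mul, norm_pow, hlam, one_pow, one_mul, h₁.2, h₂.2, one_mul, mul_one,
      norm_natCast_zpow_neg] at h
  have hy0 : y i₀ j₀ ≠ 0 := by
    rw [← norm_ne_zero_iff, hij]
    exact hpl.ne'
  have hpe0 : (p : ℚ_[p]) ^ e ≠ 0 :=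
    pow_ne_zero _ (by exact_mod_cast (Fact.out : p.Prime).ne_zero)
  have hminor : ∀ i (j : (Fin (m+1) ⊕ Unit) ⊕ Unit),
      ‖blockExt p y u (Sum.inl i) j - blockExt p y u (Sum.inl i₀) j * (y i j₀ / y i₀ j₀)‖ ≤ 1 := by
    intro i j
    have h := norm_minor_le h₁ h₂ hA (Sum.inl i) (Sum.inl i₀) j (Sum.inl j₀)
    have key : (lam • blockExt p y u) (Sum.inl i) j *
          (lam • blockExt p y u) (Sum.inl i₀) (Sum.inl j₀) -
        (lam • blockExt p y u) (Sum.inl i) (Sum.inl j₀) *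
          (lam • blockExt p y u) (Sum.inl i₀) j =
        lam ^ 2 * y i₀ j₀ * (blockExt p y u (Sum.inl i) j -
          blockExt p y u (Sum.inl i₀) j * (y i j₀ / y i₀ j₀)) := by
      have e₁ : ∀ a, blockExt p y u (Sum.inl a) (Sum.inl j₀) = y a j₀ := fun _ => rfl
      simp only [Matrix.smul_apply, smul_eq_mul, e₁]
      field_simp
    rw [key, norm_mul, norm_mul, norm_pow, hlam, one_pow, one_mul, hij] at h
    exact (mul_le_iff_le_one_right hpl).1 h
  set σ : Equiv.Perm (Fin (m+1) ⊕ Unit) := Equiv.swap i₀ (Sum.inr ()) with hσ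
  have hσ₀ : σ.symm (Sum.inr ()) = i₀ := by simp [hσ]
  set v : Fin (m+1) → ℚ_[p] := fun i =>
    ((p : ℚ_[p]) ^ e)⁻¹ * (y (σ.symm (Sum.inl i)) j₀ / y i₀ j₀) with hv
  have hpv : ∀ (x : ℚ_[p]) i, x * (p : ℚ_[p]) ^ e * v i =
      x * (y (σ.symm (Sum.inl i)) j₀ / y i₀ j₀) := fun x i => by
    rw [hv, mul_assoc, mul_inv_cancel_left₀ hpe0]
  obtain ⟨k, hk, hzk⟩ := exists_isGLZ_eq_heckeDiag_mul_Umat_mul (z := permMat p σ * y) (v := v)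
    (l := e) (by rw [norm_det_permMat_mul, hdet])
    (fun j => by rw [permMat_mul]; exact hey _ _)
    (fun i j => by
      rw [hpv, permMat_mul, Matrix.submatrix_apply, Matrix.submatrix_apply, hσ₀]
      exact hminor _ (Sum.inl j))
  refine ⟨rfl, σ, v, k, fun i => ?_, hk, hzk, ?_, fun i => ?_⟩
  · rw [hv, norm_mul, norm_inv, norm_pow, Padic.norm_p, inv_pow, inv_inv, norm_div, hij]
    exact mul_le_of_le_one_right hpl.le ((div_le_one hpl).2 (hey _ _))
  · rw [wvec_apply]
    exact (heu _).trans (pow_le_pow_right₀ hp1.le hee)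
  · rw [hpv, wvec_apply, wvec_apply, hσ₀]
    exact hminor _ (Sum.inr ())
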